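/- arXiv:1404.6175 — 3 statements merged into one kernel-verified Lean document; each statement's English description precedes it below -/
import Mathlib

section
/- Let i < j and p < q be integers with (i,j) ≠ (p,q), and suppose the pairs (i,j) and (p,q) do not alternate. Then for every real x lying in both [i,j] and [p,q], if h_{i,j}(x) = h_{p,q}(x) then x is a common endpoint of the two pairs (x ∈ {i,j} ∩ {p,q}). Equivalently, the two apex paths (the graphs of h_{i,j} over [i,j] and of h_{p,q} over [p,q]) intersect only at points (x,1) where x is a shared endpoint of the two pairs. -/
/-- The apex function `h_{a,b}(x) = 1 + (2 - 1/(b-a)) · min(x-a, b-x)` for integers `a < b`,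
whose graph over `[a,b]` is the two-segment polygonal path from `(a,1)` through the apex
`((a+b)/2, 1/2+(b-a))` to `(b,1)`. -/
noncomputable def apexFun (a b : ℤ) (x : ℝ) : ℝ :=
  1 + (2 - 1 / ((b : ℝ) - (a : ℝ))) * min (x - (a : ℝ)) ((b : ℝ) - x)

theorem apex_nested_aux
    (i j p q : ℤ) (hpq : p < q) (hne : (i, j) ≠ (p, q)) (h1 : i ≤ p) (h2 : q ≤ j)
    (x : ℝ) (hx₂ : x ∈ Set.Icc (p : ℝ) (q : ℝ))
    (heq : apexFun i j x = apexFun p q x) :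
    (x = (i : ℝ) ∨ x = (j : ℝ)) ∧ (x = (p : ℝ) ∨ x = (q : ℝ)) := by
  obtain ⟨ha, hb⟩ := hx₂
  have hlt : q - p < j - i := by
    by_contra h
    apply hne
    rw [Prod.mk.injEq]
    constructor <;> omega
  have hlt' : (q : ℝ) - p < j - i := by exact_mod_cast hlt
  have hone : (1 : ℝ) ≤ q - p := by
    have : (1 : ℤ) ≤ q - p := by omega
    exact_mod_cast this
  have h1' : (i : ℝ) ≤ p := by exact_mod_cast h1
  have h2' : (q : ℝ) ≤ j := by exact_mod_cast h2
  have hs : 1 / ((j : ℝ) - i) < 1 / ((q : ℝ) - p) :=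
    one_div_lt_one_div_of_lt (by linarith) hlt'
  have ht : 1 / ((q : ℝ) - p) ≤ 1 := by
    rw [div_le_one (by linarith)]; exact hone
  unfold apexFun at heq
  have hmn : min (x - (p : ℝ)) (q - x) ≤ min (x - (i : ℝ)) (j - x) :=
    min_le_min (by linarith) (by linarith)
  have hn : 0 ≤ min (x - (p : ℝ)) (q - x) := le_min (by linarith) (by linarith)
  have key : min (x - (p : ℝ)) (q - x) = 0 ∧ min (x - (i : ℝ)) (j - x) = 0 := by
    generalize min (x - (p : ℝ)) (q - x) = n at *
    generalize min (x - (i : ℝ)) (j - x) = m at *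
    generalize 1 / ((j : ℝ) - i) = s at *
    generalize 1 / ((q : ℝ) - p) = t at *
    have hn0 : n = 0 := by
      by_contra h
      have : 0 < n := lt_of_le_of_ne hn (Ne.symm h)
      nlinarith [mul_nonneg (by linarith : 0 ≤ 2 - s) (sub_nonneg.2 hmn),
        mul_pos (sub_pos.2 hs) this]
    refine ⟨hn0, ?_⟩
    subst hn0
    have h0 : (2 - s) * m = 0 := by linarith
    rcases mul_eq_zero.1 h0 with h | h
    · linarith
    · exact h
  obtain ⟨k1, k2⟩ := key
  constructor
  · rcases min_choice (x - (i : ℝ)) (j - x) with h | h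
    · left; linarith
    · right; linarith
  · rcases min_choice (x - (p : ℝ)) (q - x) with h | h
    · left; linarith
    · right; linarith

/-- If `(i,j)` and `(p,q)` (with `i < j`, `p < q`, `(i,j) ≠ (p,q)`) do not alternate, then the
two apex paths intersect only at points whose abscissa is a shared endpoint of the two pairs. -/
theorem apex_paths_meet_only_at_common_endpoints
    (i j p q : ℤ) (hij : i < j) (hpq : p < q) (hne : (i, j) ≠ (p, q))
    (hnalt : ¬ ((i < p ∧ p < j ∧ j < q) ∨ (p < i ∧ i < q ∧ q < j)))
    (x : ℝ) (hx₁ : x ∈ Set.Icc (i : ℝ) (j : ℝ)) (hx₂ : x ∈ Set.Icc (p : ℝ) (q : ℝ))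
    (heq : apexFun i j x = apexFun p q x) :
    (x = (i : ℝ) ∨ x = (j : ℝ)) ∧ (x = (p : ℝ) ∨ x = (q : ℝ)) := by
  by_cases c1 : i ≤ p ∧ q ≤ j
  · exact apex_nested_aux i j p q hpq hne c1.1 c1.2 x hx₂ heq
  by_cases c2 : p ≤ i ∧ j ≤ q
  · exact (apex_nested_aux p q i j hij (Ne.symm hne) c2.1 c2.2 x hx₁ heq.symm).symm
  obtain ⟨a1, a2⟩ := hx₁
  obtain ⟨b1, b2⟩ := hx₂
  have c3 : j ≤ p ∨ q ≤ i := by omega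
  rcases c3 with h | h
  · have h' : (j : ℝ) ≤ p := by exact_mod_cast h
    exact ⟨Or.inr (by linarith), Or.inl (by linarith)⟩
  · have h' : (q : ℝ) ≤ i := by exact_mod_cast h
    exact ⟨Or.inl (by linarith), Or.inr (by linarith)⟩
end

section
/- Let i < j and p < q be integers with (i,j) ≠ (p,q) that are nested with (p,q) inside (i,j), i.e., i ≤ p < q ≤ j. Then for every real x ∈ [p,q] with x ∉ {i,j}, one has h_{p,q}(x) < h_{i,j}(x); that is, except at shared endpoints, the inner apex path lies strictly below the outer apex path. -/
/-- If `(p,q)` is nested inside `(i,j)` (with `i < j`, `p < q`, `(i,j) ≠ (p,q)`), then except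
at the shared endpoints the inner apex path lies strictly below the outer apex path. -/
theorem inner_apex_path_strictly_below_outer
    (i j p q : ℤ) (hij : i < j) (hpq : p < q) (hne : (i, j) ≠ (p, q))
    (hip : i ≤ p) (hqj : q ≤ j)
    (x : ℝ) (hx : x ∈ Set.Icc (p : ℝ) (q : ℝ))
    (hxi : x ≠ (i : ℝ)) (hxj : x ≠ (j : ℝ)) :
    apexFun p q x < apexFun i j x := by
  obtain ⟨h1, h2⟩ := hx
  have hip' : (i : ℝ) ≤ p := by exact_mod_cast hip
  have hqj' : (q : ℝ) ≤ j := by exact_mod_cast hqj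
  have hpq' : (p : ℝ) + 1 ≤ q := by exact_mod_cast hpq
  have hlt : q - p < j - i := by
    by_contra hcon
    apply hne
    rw [Prod.mk.injEq]
    constructor <;> omega
  have hlt' : (q : ℝ) - p < j - i := by exact_mod_cast hlt
  have hM : 0 < min (x - (i : ℝ)) ((j : ℝ) - x) := by
    apply lt_min
    · exact sub_pos.mpr (lt_of_le_of_ne (by linarith) (Ne.symm hxi))
    · exact sub_pos.mpr (lt_of_le_of_ne (by linarith) hxj)
  have hmM : min (x - (p : ℝ)) ((q : ℝ) - x) ≤ min (x - (i : ℝ)) ((j : ℝ) - x) :=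
    min_le_min (by linarith) (by linarith)
  have hC : 1 / ((j : ℝ) - i) < 1 / ((q : ℝ) - p) :=
    one_div_lt_one_div_of_lt (by linarith) hlt'
  have hc : 1 / ((q : ℝ) - p) ≤ 1 := by
    rw [div_le_one (by linarith)]
    linarith
  unfold apexFun
  have e1 := mul_le_mul_of_nonneg_left hmM (show 0 ≤ 2 - 1 / ((q : ℝ) - p) by linarith)
  have e2 := mul_lt_mul_of_pos_right
    (show 2 - 1 / ((q : ℝ) - p) < 2 - 1 / ((j : ℝ) - i) by linarith) hM
  linarith
end

section
/- Let n ≥ 2 be a natural number and let F be a family of subsets of ZMod n such that every member A ∈ F is a proper subset of ZMod n (A ≠ ZMod n), and F is laminar: for all A, B ∈ F, either A ∩ B = ∅, or A ⊆ B, or B ⊆ A. Then there exists k ∈ ZMod n such that no member A ∈ F contains both k and k+1. -/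
/-- For `n ≥ 2`, any laminar family of proper subsets of `ZMod n` misses some cyclically
adjacent pair `k, k+1`: there is `k` such that no member contains both `k` and `k+1`. -/
theorem laminar_family_misses_adjacent_pair
    (n : ℕ) (hn : 2 ≤ n) (F : Set (Set (ZMod n)))
    (hproper : ∀ A ∈ F, A ≠ Set.univ)
    (hlaminar : ∀ A ∈ F, ∀ B ∈ F, A ∩ B = ∅ ∨ A ⊆ B ∨ B ⊆ A) :
    ∃ k : ZMod n, ∀ A ∈ F, ¬ (k ∈ A ∧ k + 1 ∈ A) := by
  haveI : NeZero n := ⟨by omega⟩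
  by_contra hcon
  push Not at hcon
  obtain ⟨A, hA, h0, -⟩ := hcon 0
  obtain ⟨M, hAM, hM⟩ := (Set.toFinite F).exists_le_maximal hA
  have step : ∀ k ∈ M, k + 1 ∈ M := by
    intro k hk
    obtain ⟨B, hB, hkB, hkB1⟩ := hcon k
    rcases hlaminar B hB M hM.prop with h | h | h
    · exact absurd (show k ∈ B ∩ M from ⟨hkB, hk⟩) (by simp [h])
    · exact h hkB1
    · exact hM.le_of_ge hB h hkB1
  have all : ∀ m : ℕ, (m : ZMod n) ∈ M := by
    intro m
    induction m with
    | zero => simpa using hAM h0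
    | succ m ih => simpa using step _ ih
  apply hproper M hM.prop
  ext x
  simpa using all x.val
end
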